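/- arXiv:0912.4240 — 2 statements merged into one kernel-verified Lean document; each statement's English description precedes it below -/
import Mathlib

section
/- For every n ≥ 1, E_n/n! = 2 (2/π)^{n+1} Σ_{k≥0} (−1)^{k(n+1)} / (2k+1)^{n+1}, where the series on the right converges. -/
def IsAltPerm {n : ℕ} (w : Equiv.Perm (Fin n)) : Prop :=
  ∀ j : ℕ, ∀ h : j + 1 < n,
    (Even j → w ⟨j + 1, h⟩ < w ⟨j, Nat.lt_of_succ_lt h⟩) ∧
    (¬ Even j → w ⟨j, Nat.lt_of_succ_lt h⟩ < w ⟨j + 1, h⟩)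

noncomputable def eulerNumber (n : ℕ) : ℕ :=
  Nat.card {w : Equiv.Perm (Fin n) // IsAltPerm w}

/-- Prepend the value `p` to the complement of `w`. -/
def consPerm {n : ℕ} (p : Fin (n + 1)) (w : Equiv.Perm (Fin n)) : Equiv.Perm (Fin (n + 1)) :=
  (finSuccEquiv' 0).trans ((Equiv.optionCongr (w.trans Fin.revPerm)).trans (finSuccEquiv' p).symm)

lemma consPerm_zero {n : ℕ} (p : Fin (n + 1)) (w : Equiv.Perm (Fin n)) :
    consPerm p w 0 = p := by
  simp [consPerm]

lemma consPerm_succ {n : ℕ} (p : Fin (n + 1)) (w : Equiv.Perm (Fin n)) (i : Fin n) :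
    consPerm p w i.succ = p.succAbove (w i).rev := by
  have h : finSuccEquiv' (0 : Fin (n + 1)) i.succ = some i := by
    rw [← Fin.succAbove_zero]; exact finSuccEquiv'_succAbove 0 i
  simp [consPerm, h]

lemma consPerm_inj {n : ℕ} :
    Function.Injective (fun q : Fin (n + 1) × Equiv.Perm (Fin n) => consPerm q.1 q.2) := by
  rintro ⟨p, w⟩ ⟨p', w'⟩ h
  simp only at h
  have h0 : p = p' := by rw [← consPerm_zero p w, h, consPerm_zero]
  subst h0
  congr 1
  ext i
  have := consPerm_succ p w i
  rw [h, consPerm_succ] at this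
  rw [Fin.rev_injective (Fin.succAbove_right_injective this)]

lemma consPerm_bij {n : ℕ} :
    Function.Bijective (fun q : Fin (n + 1) × Equiv.Perm (Fin n) => consPerm q.1 q.2) := by
  rw [Fintype.bijective_iff_injective_and_card]
  refine ⟨consPerm_inj, ?_⟩
  simp [Fintype.card_perm, Nat.factorial_succ]

lemma consPerm_alt {n : ℕ} (p : Fin (n + 2)) (w : Equiv.Perm (Fin (n + 1))) :
    IsAltPerm (consPerm p w) ↔ IsAltPerm w ∧ n + 1 - (p : ℕ) ≤ (w 0 : ℕ) := by
  have key : ∀ j (h : j + 1 < n + 2), consPerm p w ⟨j + 1, h⟩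
      = p.succAbove (w ⟨j, by omega⟩).rev := fun j h => consPerm_succ p w ⟨j, by omega⟩
  have h0 : consPerm p w ⟨0 + 1, by omega⟩ < consPerm p w ⟨0, by omega⟩
      ↔ n + 1 - (p : ℕ) ≤ (w 0 : ℕ) := by
    rw [key]
    have : consPerm p w ⟨0, by omega⟩ = p := consPerm_zero p w
    rw [this, Fin.succAbove_lt_iff_castSucc_lt, Fin.lt_def]
    simp only [Fin.val_castSucc, Fin.val_rev]
    have := (w 0).isLt
    have := p.isLt
    change n + 1 - ((w 0 : ℕ) + 1) < _ ↔ _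
    omega
  constructor
  · intro H
    refine ⟨?_, h0.1 ((H 0 (by omega)).1 (by simp))⟩
    intro j h
    have := H (j + 1) (by omega)
    rw [key, key] at this
    simp only [Fin.succAbove_lt_succAbove_iff, Fin.rev_lt_rev, Nat.even_add_one, not_not] at this
    exact ⟨this.2, this.1⟩
  · rintro ⟨H, hp⟩ j h
    cases j with
    | zero => exact ⟨fun _ => h0.2 hp, fun h => absurd (by simp) h⟩
    | succ j =>
      have := H j (by omega)
      rw [key, key]
      simp only [Fin.succAbove_lt_succAbove_iff, Fin.rev_lt_rev, Nat.even_add_one, not_not]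
      exact ⟨this.2, this.1⟩

/-- Alternating permutations of `Fin (n+1)` whose first value is at least `k`. -/
noncomputable def entr (n k : ℕ) : ℕ :=
  Nat.card {w : Equiv.Perm (Fin (n + 1)) // IsAltPerm w ∧ k ≤ (w 0 : ℕ)}

lemma entr_zero_right (n : ℕ) : entr n 0 = eulerNumber (n + 1) := by
  simp [entr, eulerNumber]

lemma entr_top (n : ℕ) : entr n (n + 1) = 0 := by
  unfold entr
  have : IsEmpty {w : Equiv.Perm (Fin (n + 1)) // IsAltPerm w ∧ n + 1 ≤ (w 0 : ℕ)} := by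
    constructor
    rintro ⟨w, -, h⟩
    have := (w 0).isLt
    omega
  exact Nat.card_of_isEmpty

lemma entr_zero_zero : entr 0 0 = 1 := by
  unfold entr
  have : ∀ w : Equiv.Perm (Fin (0 + 1)), IsAltPerm w ∧ 0 ≤ (w 0 : ℕ) := by
    intro w
    exact ⟨fun j h => by omega, by omega⟩
  rw [Nat.card_congr (Equiv.subtypeUnivEquiv this)]
  simp

lemma entr_first (n k : ℕ) (hk : k ≤ n + 1) :
    Nat.card {w : Equiv.Perm (Fin (n + 2)) // IsAltPerm w ∧ (w 0 : ℕ) = k}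
      = entr n (n + 1 - k) := by
  symm
  unfold entr
  let p : Fin (n + 2) := ⟨k, by omega⟩
  refine Nat.card_congr (Equiv.ofBijective
    (fun w => ⟨consPerm p w.1, (consPerm_alt p w.1).2 w.2, by rw [consPerm_zero]⟩) ⟨?_, ?_⟩)
  · rintro ⟨w, hw⟩ ⟨w', hw'⟩ h
    have h1 : consPerm p w = consPerm p w' := congrArg Subtype.val h
    have := @consPerm_inj _ (p, w) (p, w') h1
    simpa using this
  · rintro ⟨v, hv, hv0⟩
    obtain ⟨⟨q, w⟩, rfl⟩ := consPerm_bij.2 v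
    simp only at hv hv0
    rw [consPerm_zero] at hv0
    have : q = p := Fin.ext hv0
    subst this
    exact ⟨⟨w, (consPerm_alt _ w).1 hv⟩, rfl⟩

lemma entr_rec (n k : ℕ) (hk : k ≤ n + 1) :
    entr (n + 1) k = entr (n + 1) (k + 1) + entr n (n + 1 - k) := by
  classical
  rw [← entr_first n k hk]
  unfold entr
  simp only [Nat.card_eq_fintype_card, Fintype.card_subtype]
  rw [← Finset.card_union_of_disjoint]
  · congr 1
    ext w
    simp only [Finset.mem_filter, Finset.mem_univ, true_and, Finset.mem_union, ← and_or_left]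
    refine and_congr_right fun _ => ?_
    omega
  · rw [Finset.disjoint_filter]
    rintro w - ⟨-, h⟩ ⟨-, h'⟩
    omega

/-- The polynomial density in the Bernstein basis. -/
noncomputable def entrPoly (n : ℕ) : Polynomial ℝ :=
  ∑ k ∈ Finset.range (n + 2), (entr n k : Polynomial ℝ) * bernsteinPolynomial ℝ (n + 1) k

lemma entrPoly_derivative (n : ℕ) : (entrPoly (n + 1)).derivative
    = -((n : Polynomial ℝ) + 2) * (entrPoly n).comp (1 - Polynomial.X) := by
  have h1 : (entrPoly (n + 1)).derivative = (n + 2 : Polynomial ℝ) *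
      (∑ k ∈ Finset.range (n + 2), (entr (n + 1) (k + 1) : Polynomial ℝ)
          * bernsteinPolynomial ℝ (n + 1) k
        - ∑ k ∈ Finset.range (n + 3), (entr (n + 1) k : Polynomial ℝ)
          * bernsteinPolynomial ℝ (n + 1) k) := by
    unfold entrPoly
    rw [Finset.sum_range_succ', Finset.sum_range_succ' _ (n + 2), Polynomial.derivative_add,
      Polynomial.derivative_sum]
    simp only [Polynomial.derivative_mul, Polynomial.derivative_natCast, zero_mul, zero_add,
      bernsteinPolynomial.derivative_succ, bernsteinPolynomial.derivative_zero]
    rw [← sub_sub, ← Finset.sum_sub_distrib, mul_sub, Finset.mul_sum]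
    rw [sub_eq_add_neg]
    congr 1
    · refine Finset.sum_congr rfl fun k _ => ?_
      simp only [Nat.add_sub_cancel]
      push_cast
      ring
    · simp only [Nat.add_sub_cancel]
      push_cast
      ring
  rw [h1, Finset.sum_range_succ _ (n + 2),
    bernsteinPolynomial.eq_zero_of_lt ℝ (show n + 1 < n + 2 by omega), mul_zero, add_zero,
    ← Finset.sum_sub_distrib, neg_mul, ← mul_neg]
  congr 1
  unfold entrPoly
  rw [Polynomial.sum_comp, ← Finset.sum_range_reflect, ← Finset.sum_neg_distrib]
  refine Finset.sum_congr rfl fun k hk => ?_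
  have hk' : k ≤ n + 1 := by have := Finset.mem_range.1 hk; omega
  have e : n + 2 - 1 - k = n + 1 - k := by omega
  rw [e, entr_rec n (n + 1 - k) (by omega), Nat.sub_sub_self hk', Polynomial.mul_comp,
    bernsteinPolynomial.flip _ _ _ hk', Polynomial.natCast_comp]
  push_cast
  ring

/-- Normalized density. -/
noncomputable def dens (n : ℕ) (x : ℝ) : ℝ := (entrPoly n).eval x / (n + 1).factorial

lemma dens_zero (n : ℕ) : dens n 0 = (eulerNumber (n + 1) : ℝ) / (n + 1).factorial := by
  unfold dens entrPoly
  rw [← entr_zero_right, Polynomial.eval_finsetSum]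
  congr 1
  simp [bernsteinPolynomial.eval_at_0, -Nat.cast_eq_zero]

lemma dens_one (n : ℕ) : dens n 1 = 0 := by
  unfold dens entrPoly
  rw [Polynomial.eval_finsetSum, Finset.sum_range_succ]
  rw [entr_top, Finset.sum_eq_zero]
  · simp
  · intro k hk
    have := Finset.mem_range.1 hk
    have : k ≠ n + 1 := by omega
    simp [bernsteinPolynomial.eval_at_1, this]

lemma dens_base (x : ℝ) : dens 0 x = 1 - x := by
  have := entr_top 0
  simp at this
  simp [dens, entrPoly, Finset.sum_range_succ, this, entr_zero_zero, bernsteinPolynomial]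

lemma dens_hasDerivAt (n : ℕ) (x : ℝ) : HasDerivAt (dens (n + 1)) (-dens n (1 - x)) x := by
  have h : HasDerivAt (dens (n + 1)) _ x :=
    ((entrPoly (n + 1)).hasDerivAt x).div_const ((n + 1 + 1).factorial : ℝ)
  rw [entrPoly_derivative] at h
  refine h.congr_deriv ?_
  unfold dens
  rw [Nat.factorial_succ (n + 1)]
  have : ((n + 1).factorial : ℝ) ≠ 0 := by positivity
  have h2 : (n : ℝ) + 2 ≠ 0 := by positivity
  simp
  field_simp
  ring

lemma dens_continuous (n : ℕ) : Continuous (dens n) := by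
  unfold dens
  exact (entrPoly n).continuous.div_const _

lemma dens_integral (n : ℕ) (x : ℝ) : ∫ t in (0 : ℝ)..(1 - x), dens n t = dens (n + 1) x := by
  have h : ∀ t ∈ Set.uIcc (0 : ℝ) (1 - x),
      HasDerivAt (fun t => dens (n + 1) (1 - t)) (dens n t) t := by
    intro t _
    refine ((dens_hasDerivAt n (1 - t)).comp_const_sub 1 t).congr_deriv ?_
    simp
  rw [intervalIntegral.integral_eq_sub_of_hasDerivAt h ((dens_continuous n).intervalIntegrable _ _)]
  simp [dens_one]

/-- Frequencies. -/
noncomputable def freq (k : ℕ) : ℝ := (2 * k + 1) * Real.pi / 2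

lemma freq_pos (k : ℕ) : 0 < freq k := by
  unfold freq
  positivity

lemma sin_freq (k : ℕ) (x : ℝ) :
    Real.sin (freq k * (1 - x)) = (-1) ^ k * Real.cos (freq k * x) := by
  have : freq k * (1 - x) = (Real.pi / 2 - freq k * x) + k * Real.pi := by
    unfold freq; ring
  rw [this, Real.sin_add_nat_mul_pi, Real.sin_pi_div_two_sub]

lemma bern_two_eval (y : ℝ) :
    (Polynomial.map (algebraMap ℚ ℝ) (Polynomial.bernoulli 2)).eval y = y ^ 2 - y + 1 / 6 := by
  simp [Polynomial.bernoulli, Finset.sum_range_succ, bernoulli_one, bernoulli_two]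
  ring

lemma hasSum_cast_of {f g : ℕ → ℝ} {s t : ℝ} (h : HasSum f s) (hfg : ∀ k, g k = f k)
    (hst : t = s) : HasSum g t := by
  have : g = f := funext hfg
  rw [this, hst]
  exact h

lemma hasSum_odd_of_even {f : ℕ → ℝ} {s e : ℝ} (hf : HasSum f s)
    (he : HasSum (fun k => f (2 * k)) e) : HasSum (fun k => f (2 * k + 1)) (s - e) := by
  have h : Summable (fun k => f (2 * k + 1)) :=
    hf.summable.comp_injective (i := fun k => 2 * k + 1) (fun a b h => by simpa using h)
  have h2 := (he.even_add_odd h.hasSum).unique hf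
  rw [← h2, add_sub_cancel_left]
  exact h.hasSum

lemma series_base (x : ℝ) (hx : x ∈ Set.Icc (0 : ℝ) 1) :
    HasSum (fun k : ℕ => 2 / freq k ^ 2 * Real.cos (freq k * x)) (1 - x) := by
  have h1 := hasSum_one_div_nat_pow_mul_cos one_ne_zero
    (show x / 4 ∈ Set.Icc (0 : ℝ) 1 from ⟨by linarith [hx.1], by linarith [hx.2]⟩)
  have h2 := (hasSum_one_div_nat_pow_mul_cos one_ne_zero
    (show x / 2 ∈ Set.Icc (0 : ℝ) 1 from ⟨by linarith [hx.1], by linarith [hx.2]⟩)).mul_left (1 / 4)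
  rw [mul_one, bern_two_eval] at h1 h2
  have h3 := hasSum_odd_of_even h1 (e := _) (by
    refine hasSum_cast_of h2 (fun k => ?_) rfl
    have : 2 * Real.pi * ((2 * k : ℕ) : ℝ) * (x / 4) = 2 * Real.pi * k * (x / 2) := by
      push_cast; ring
    rw [this]
    push_cast
    rw [mul_pow, ← mul_assoc]
    congr 1
    rw [one_div_mul_one_div]
    norm_num)
  have hpi := Real.pi_pos.ne'
  refine hasSum_cast_of (h3.mul_left (8 / Real.pi ^ 2)) (fun k => ?_) ?_
  · have : 2 * Real.pi * ((2 * k + 1 : ℕ) : ℝ) * (x / 4) = freq k * x := by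
      unfold freq; push_cast; ring
    rw [this, ← mul_assoc]
    congr 1
    unfold freq
    push_cast
    field_simp
    norm_num
  · simp [Nat.factorial]
    field_simp
    ring

lemma freq_summable (n : ℕ) : Summable (fun k : ℕ => 2 / freq k ^ (n + 2)) := by
  have h0 : Summable (fun k : ℕ => 2 / freq k ^ 2) := by
    have := (series_base 0 (by simp)).summable
    simpa using this
  refine Summable.of_nonneg_of_le (fun k => ?_) (fun k => ?_) h0
  · have := freq_pos k
    positivity
  · have h1 : 1 ≤ freq k := by
      unfold freq
      have := Real.two_le_pi
      have : (0 : ℝ) ≤ k := by positivity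
      nlinarith
    have := freq_pos k
    gcongr
    omega

lemma series_dens (n : ℕ) (x : ℝ) (hx : x ∈ Set.Icc (0 : ℝ) 1) :
    HasSum (fun k : ℕ => (-1) ^ (k * n) * (2 / freq k ^ (n + 2)) * Real.cos (freq k * x))
      (dens n x) := by
  induction n generalizing x with
  | zero =>
    rw [dens_base]
    simpa using series_base x hx
  | succ n ih =>
    rw [← dens_integral]
    have key : HasSum (fun k : ℕ => ∫ t in (0 : ℝ)..(1 - x),
        (-1) ^ (k * n) * (2 / freq k ^ (n + 2)) * Real.cos (freq k * t))
        (∫ t in (0 : ℝ)..(1 - x), dens n t) := by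
      refine intervalIntegral.hasSum_integral_of_dominated_convergence
        (fun k _ => 2 / freq k ^ (n + 2)) ?_ ?_ ?_ ?_ ?_
      · intro k
        exact Continuous.aestronglyMeasurable (by fun_prop)
      · intro k
        filter_upwards with t _
        have hp := freq_pos k
        have h2 : 0 ≤ 2 / freq k ^ (n + 2) := by positivity
        rw [norm_mul, norm_mul, norm_pow, norm_neg, norm_one, one_pow, one_mul,
          Real.norm_of_nonneg h2]
        exact mul_le_of_le_one_right h2 (Real.abs_cos_le_one _)
      · filter_upwards with t _
        exact freq_summable n
      · exact intervalIntegrable_const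
      · filter_upwards with t ht
        rw [Set.uIoc_of_le (by linarith [hx.2])] at ht
        exact ih t ⟨ht.1.le, by linarith [ht.2, hx.1]⟩
    refine hasSum_cast_of key (fun k => ?_) rfl
    have hp := (freq_pos k).ne'
    rw [intervalIntegral.integral_const_mul, intervalIntegral.integral_comp_mul_left _ hp,
      integral_cos, mul_zero, Real.sin_zero, sub_zero, sin_freq, smul_eq_mul, mul_add, pow_add,
      mul_one, show n + 1 + 2 = (n + 2) + 1 by omega, pow_succ (freq k)]
    field_simp

theorem euler_asymptotic_series (n : ℕ) (hn : 1 ≤ n) :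
    ∃ S : ℝ,
      HasSum (fun k : ℕ => (-1 : ℝ) ^ (k * (n + 1)) / (2 * (k : ℝ) + 1) ^ (n + 1)) S ∧
      (eulerNumber n : ℝ) / n.factorial = 2 * (2 / Real.pi) ^ (n + 1) * S := by
  obtain ⟨m, rfl⟩ : ∃ m, n = m + 1 := ⟨n - 1, by omega⟩
  have h := series_dens m 0 (by simp)
  rw [dens_zero] at h
  have hpi := Real.pi_pos.ne'
  have hc : 2 * (2 / Real.pi) ^ (m + 1 + 1) ≠ 0 := by positivity
  refine ⟨(eulerNumber (m + 1) : ℝ) / (m + 1).factorial / (2 * (2 / Real.pi) ^ (m + 1 + 1)), ?_,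
    by field_simp⟩
  refine hasSum_cast_of (h.div_const (2 * (2 / Real.pi) ^ (m + 1 + 1))) (fun k => ?_) rfl
  have e : (-1 : ℝ) ^ (k * (m + 1 + 1)) = (-1) ^ (k * m) := by
    rw [add_assoc, mul_add, pow_add, mul_comm k (1 + 1), pow_mul (-1 : ℝ) (1 + 1)]
    norm_num
  have hk : (2 * (k : ℝ) + 1) ≠ 0 := by positivity
  have e2 : freq k = (2 * (k : ℝ) + 1) / (2 / Real.pi) := by
    unfold freq; field_simp
  rw [e, e2, mul_zero, Real.cos_zero, mul_one, div_pow]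
  have : (2 / Real.pi) ^ (m + 2) ≠ 0 := by positivity
  field_simp
end

section
/- For all k, n ≥ 1, b_k(n) = (1/2^{k−1}) · Σ (−2)^s C(k−s, (k+r)/2) C(n,s) r^n, where the sum is over all integers r, s ≥ 0 with r + 2s ≤ k and r ≡ k (mod 2); moreover a_k(n) = b_k(n) − b_{k−1}(n). -/
/-- `s` is a list of positions `i_1 < i_2 < ⋯ < i_k`, and the corresponding values
`w(i_1), w(i_2), …` alternate, descending first: `w(i_1) > w(i_2) < w(i_3) > ⋯`. -/
def IsAltSubseq {n : ℕ} (w : Equiv.Perm (Fin n)) (s : List (Fin n)) : Prop :=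
  s.Chain' (· < ·) ∧
  ∀ j : ℕ, ∀ h : j + 1 < s.length,
    (Even j → w (s.get ⟨j + 1, h⟩) < w (s.get ⟨j, Nat.lt_of_succ_lt h⟩)) ∧
    (¬ Even j → w (s.get ⟨j, Nat.lt_of_succ_lt h⟩) < w (s.get ⟨j + 1, h⟩))

/-- `as(w)`: the length of the longest alternating subsequence of `w`. -/
noncomputable def altSubseqLen {n : ℕ} (w : Equiv.Perm (Fin n)) : ℕ :=
  sSup {k : ℕ | ∃ s : List (Fin n), IsAltSubseq w s ∧ s.length = k}

/-- `a_k(n) = #{w ∈ S_n : as(w) = k}`. -/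
noncomputable def akn (k n : ℕ) : ℕ :=
  Nat.card {w : Equiv.Perm (Fin n) // altSubseqLen w = k}

/-- `b_k(n) = #{w ∈ S_n : as(w) ≤ k}`. -/
noncomputable def bkn (k n : ℕ) : ℕ :=
  Nat.card {w : Equiv.Perm (Fin n) // altSubseqLen w ≤ k}

def hh (p n k : ℕ) : ℚ := ∑ s ∈ Finset.range (k + 1), (-2 : ℚ) ^ s * ((k - s).choose p) * (n.choose s)

lemma hh_succ (p n k : ℕ) : hh p (n+1) (k+1) = hh p n (k+1) - 2 * hh p n k := by
  unfold hh
  rw [Finset.sum_range_succ' _ (k+1), Finset.sum_range_succ' _ (k+1), Finset.mul_sum]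
  simp only [Nat.choose_zero_right, Nat.choose_succ_succ, Nat.reduceSubDiff, Nat.cast_add, mul_add, Finset.sum_add_distrib]
  have : ∀ x ∈ Finset.range (k+1), (-2 : ℚ) ^ (x + 1) * ((k - x).choose p) * (n.choose x) = - (2 * ((-2 : ℚ) ^ (x) * ((k - x).choose p) * (n.choose x))) := by
    intro x _; ring
  rw [Finset.sum_congr rfl this, Finset.sum_neg_distrib]
  ring

lemma hh_zero_right (p n : ℕ) : hh p n 0 = ((0 : ℕ).choose p) := by
  simp [hh]

lemma hh_zero_mid (p k : ℕ) : hh p 0 k = (k.choose p) := by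
  unfold hh
  rw [Finset.sum_range_succ']
  simp

lemma hh_pascal (p n k : ℕ) : hh (p+1) n (k+1) = hh p n k + hh (p+1) n k := by
  unfold hh
  rw [Finset.sum_range_succ _ (k+1), ← Finset.sum_add_distrib]
  simp only [Nat.sub_self, Nat.choose_zero_succ, Nat.cast_zero, mul_zero, zero_mul, add_zero]
  refine Finset.sum_congr rfl fun s hs => ?_
  rw [Finset.mem_range] at hs
  rw [show k + 1 - s = (k - s) + 1 by omega, Nat.choose_succ_succ]
  push_cast; ring

lemma hh_eq_zero (p n k : ℕ) (h : k < p) : hh p n k = 0 := by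
  unfold hh
  refine Finset.sum_eq_zero fun s hs => ?_
  rw [Nat.choose_eq_zero_of_lt (by omega)]; simp

lemma hh_ident (n : ℕ) : ∀ p k : ℕ, (2 * ((p : ℚ) + 1) - (k + 2)) * hh (p+1) (n+1) (k+2)
    = (k + 2) * hh (p+1) n (k+2) + 4 * ((n : ℚ) - 1 - k) * hh p n k := by
  induction n with
  | zero =>
    intro p k
    rw [hh_succ]
    simp only [hh_zero_mid]
    have e1 : ((k:ℚ)+1+1) * ((k+1).choose p) = ((k+2).choose (p+1)) * ((p:ℚ)+1) := by
      exact_mod_cast Nat.add_one_mul_choose_eq (k+1) p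
    have e2 : ((k:ℚ)+1) * (k.choose p) = ((k+1).choose (p+1)) * ((p:ℚ)+1) := by
      exact_mod_cast Nat.add_one_mul_choose_eq k p
    have e3 : (((k+2).choose (p+1) : ℕ):ℚ) = (k+1).choose p + (k+1).choose (p+1) := by
      exact_mod_cast Nat.choose_succ_succ (k+1) p
    rw [e3] at e1 ⊢
    push_cast
    linear_combination (-2) * e1 + 4 * e2
  | succ n ih =>
    intro p k
    cases k with
    | zero =>
      have h1 := ih p 0
      have a := hh_succ (p+1) (n+1) 1
      have b := hh_succ (p+1) n 1
      have c := hh_pascal p n 0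
      have c' := hh_pascal p (n+1) 0
      have px : (p : ℚ) * ((0 : ℕ).choose p : ℚ) = 0 := by
        cases p <;> simp
      simp only [hh_zero_right, Nat.choose_zero_succ, Nat.cast_zero, add_zero, zero_add, Nat.reduceAdd] at *
      push_cast at *
      rw [a, c']
      rw [c] at b
      linear_combination h1 - 2 * b - 4 * px
    | succ k =>
      have h1 := ih p (k+1)
      have h2 := ih p k
      have a := hh_succ (p+1) (n+1) (k+2)
      have b := hh_succ (p+1) n (k+2)
      have b' := hh_succ (p+1) n (k+1)
      have d := hh_succ p n k
      have c := hh_pascal p n (k+1)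
      simp only [Nat.add_assoc, Nat.reduceAdd] at *
      push_cast at *
      rw [a, d]
      linear_combination h1 - 2 * h2 - (k + 3) * b + 2 * b' + 4 * c

def WW (k p : ℕ) : ℚ := if k < 2 * p then 1 else if k = 2 * p then 1/2 else 0

def FF (k n : ℕ) : ℚ := 2 / 2 ^ k * ∑ p ∈ Finset.range (k+1), WW k p * hh p n k * (2 * (p:ℚ) - k) ^ n

lemma FF_zero (k : ℕ) : FF k 0 = 1 := by
  unfold FF
  simp only [hh_zero_mid, pow_zero, mul_one]
  have h := Finset.sum_range_reflect (fun p => WW k p * (k.choose p : ℚ)) (k+1)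
  have h2 : ∑ p ∈ Finset.range (k+1), WW k p * (k.choose p : ℚ) + ∑ p ∈ Finset.range (k+1), WW k p * (k.choose p : ℚ) = 2 ^ k := by
    nth_rewrite 1 [← h]
    rw [← Finset.sum_add_distrib]
    have := Nat.sum_range_choose k
    rw [← Nat.cast_inj (R := ℚ)] at this
    push_cast at this
    rw [← this]
    refine Finset.sum_congr rfl fun p hp => ?_
    rw [Finset.mem_range] at hp
    rw [show k + 1 - 1 - p = k - p by omega, Nat.choose_symm (by omega), ← add_mul]
    have : WW k (k-p) + WW k p = 1 := by
      unfold WW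
      rcases lt_trichotomy k (2*p) with h | h | h
      · rw [if_neg (by omega), if_neg (by omega), if_pos h]; norm_num
      · rw [if_neg (by omega), if_pos (by omega), if_neg (by omega), if_pos h]; norm_num
      · rw [if_pos (by omega), if_neg (by omega), if_neg (by omega)]; norm_num
    rw [this, one_mul]
  have : (2:ℚ)^k ≠ 0 := by positivity
  field_simp
  linarith

lemma FF_zero_left (n : ℕ) : FF 0 (n+1) = 0 := by
  simp [FF]

lemma FF_one (n : ℕ) : FF 1 n = 1 := by
  have : hh 1 n 1 = 1 := by
    have := hh_pascal 0 n 0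
    simpa [hh_zero_right] using this
  simp [FF, Finset.sum_range_succ, WW, this]
  norm_num

lemma FF_rec (k n : ℕ) : FF (k+2) (n+1) = (k+2) * FF (k+2) n + ((n:ℚ) - 1 - k) * FF k n := by
  unfold FF
  rw [Finset.sum_range_succ', Finset.sum_range_succ' _ (k+2)]
  have hw : WW (k+2) 0 = 0 := by simp [WW]
  have hk : ∑ p ∈ Finset.range (k+1), WW k p * hh p n k * (2 * (p:ℚ) - k) ^ n = ∑ p ∈ Finset.range (k+2), WW k p * hh p n k * (2 * (p:ℚ) - k) ^ n := by
    rw [Finset.sum_range_succ _ (k+1), hh_eq_zero (k+1) n k (by omega)]; simp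
  rw [hw, hk]
  simp only [zero_mul, add_zero]
  simp only [Finset.mul_sum, ← Finset.sum_add_distrib]
  refine Finset.sum_congr rfl fun p hp => ?_
  have e : WW (k+2) (p+1) = WW k p := by
    simp only [WW, show k + 2 < 2 * (p+1) ↔ k < 2 * p by omega, show k + 2 = 2 * (p+1) ↔ k = 2 * p by omega]
  have := hh_ident n p k
  rw [e, pow_succ]
  have h2 : (2:ℚ)^k ≠ 0 := by positivity
  have e2 : (2:ℚ) * ((p+1:ℕ):ℚ) - ((k+2:ℕ):ℚ) = 2 * p - k := by push_cast; ring
  rw [e2]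
  have e3 : (2 * ((p : ℚ) + 1) - (k + 2)) = 2 * p - k := by ring
  rw [e3] at this
  rw [pow_add]
  field_simp
  linear_combination WW k p * (2 * (p:ℚ) - k)^n * this

lemma FF_formula (k n : ℕ) (hk : 1 ≤ k) (hn : 1 ≤ n) : FF k n = (1 / 2 ^ (k - 1)) *
        ∑ r ∈ Finset.range (k + 1), ∑ s ∈ Finset.range (k + 1),
          if r + 2 * s ≤ k ∧ r % 2 = k % 2 then
            (-2 : ℚ) ^ s * ((k - s).choose ((k + r) / 2)) * (n.choose s) * (r : ℚ) ^ n
          else 0 := by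
  have e1 : ∀ r ∈ Finset.range (k+1), (∑ s ∈ Finset.range (k + 1),
          if r + 2 * s ≤ k ∧ r % 2 = k % 2 then
            (-2 : ℚ) ^ s * ((k - s).choose ((k + r) / 2)) * (n.choose s) * (r : ℚ) ^ n
          else 0) = if r % 2 = k % 2 then hh ((k+r)/2) n k * (r:ℚ)^n else 0 := by
    intro r hr
    rw [Finset.mem_range] at hr
    split_ifs with h
    · unfold hh
      rw [Finset.sum_mul]
      refine Finset.sum_congr rfl fun s hs => ?_
      rw [Finset.mem_range] at hs
      split_ifs with h'
      · rfl
      · rw [Nat.choose_eq_zero_of_lt (by omega)]; simp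
    · simp [h]
  rw [Finset.sum_congr rfl e1]
  unfold FF
  obtain ⟨k, rfl⟩ : ∃ j, k = j + 1 := ⟨k - 1, by omega⟩
  have e2 : (2:ℚ) / 2 ^ (k+1) = 1 / 2 ^ (k + 1 - 1) := by
    rw [Nat.add_sub_cancel, pow_succ]; field_simp
  rw [e2]
  congr 1
  rw [← Finset.sum_filter]
  symm
  have e3 : ∀ p ∈ Finset.range (k+1+1), WW (k+1) p * hh p n (k+1) * (2 * (p:ℚ) - (k+1:ℕ)) ^ n = if k + 1 ≤ 2 * p then hh p n (k+1) * (2 * (p:ℚ) - (k+1:ℕ)) ^ n else 0 := by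
    intro p _
    unfold WW
    rcases lt_trichotomy (k+1) (2*p) with h | h | h
    · rw [if_pos h, if_pos h.le]; ring
    · have : (2 * (p:ℚ) - (k+1:ℕ)) = 0 := by rw [h]; push_cast; ring
      rw [this, zero_pow (by omega)]; simp
    · rw [if_neg (by omega), if_neg (by omega), if_neg (by omega)]; simp
  rw [Finset.sum_congr rfl e3, ← Finset.sum_filter]
  refine Finset.sum_nbij' (fun r => (k+1+r)/2) (fun p => 2 * p - (k+1)) ?_ ?_ ?_ ?_ ?_
  · intro r hr; simp only [Finset.mem_filter, Finset.mem_range] at *; omega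
  · intro r hr; simp only [Finset.mem_filter, Finset.mem_range] at *; omega
  · intro r hr; simp only [Finset.mem_filter, Finset.mem_range] at *; omega
  · intro r hr; simp only [Finset.mem_filter, Finset.mem_range] at *; omega
  · intro r hr; simp only [Finset.mem_filter, Finset.mem_range] at *
    congr 2
    have : 2 * ((k+1+r)/2) = k + 1 + r := by omega
    have : (2:ℚ) * (((k+1+r)/2 : ℕ):ℚ) = ((k + 1 + r : ℕ) : ℚ) := by exact_mod_cast this
    rw [this]; push_cast; ring

/-- Step relation: going down for `true`, up for `false`. -/
def RR (b : Bool) (x y : ℕ) : Prop := if b then y < x else x < y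

instance (b : Bool) (x y : ℕ) : Decidable (RR b x y) := by unfold RR; infer_instance

/-- Number of further elements picked greedily. -/
def run : Bool → ℕ → List ℕ → ℕ
  | _, _, [] => 0
  | b, x, y :: l => if RR b x y then 1 + run (!b) y l else run b y l

def Alt : Bool → List ℕ → Prop
  | _, [] => True
  | _, [_] => True
  | b, x :: y :: l => RR b x y ∧ Alt (!b) (y :: l)

lemma run_le (l : List ℕ) : ∀ b x x', run b x l ≤ 1 + run (!b) x' l := by
  induction l with
  | nil => intros; simp [run]
  | cons y l ih =>
    intro b x x'
    have h1 := ih b y y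
    have h2 := ih (!b) y y
    simp only [run, Bool.not_not] at *
    split_ifs <;> omega

lemma run_mono (l : List ℕ) (b : Bool) (x x' : ℕ) (h : ¬ RR b x x') : run b x l ≤ run b x' l := by
  cases l with
  | nil => simp [run]
  | cons y l =>
    have h1 := run_le l b y y
    simp only [run]
    split_ifs with h2 h3
    · omega
    · exfalso
      cases b <;> simp [RR] at * <;> omega
    · omega
    · omega

lemma run_upper (l : List ℕ) : ∀ (b : Bool) (x : ℕ) (s : List ℕ), s.Sublist l → Alt b (x :: s) →
    s.length ≤ run b x l := by
  induction l with
  | nil => intro b x s hs _; simp [List.sublist_nil.1 hs]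
  | cons y l ih =>
    intro b x s hs ha
    cases hs with
    | cons _ hs =>
      refine (ih b x s hs ha).trans ?_
      simp only [run]
      split_ifs with h
      · exact run_le l b x y
      · exact run_mono l b x y h
    | cons_cons _ hs =>
      obtain ⟨h1, h2⟩ := ha
      have := ih _ _ _ hs h2
      simp only [run, if_pos h1, List.length_cons]
      omega

lemma run_exists (l : List ℕ) : ∀ (b : Bool) (x : ℕ), ∃ (h : ℕ) (s : List ℕ), (h :: s).Sublist (x :: l) ∧
    Alt b (h :: s) ∧ s.length = run b x l ∧ ¬ RR b x h := by
  induction l with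
  | nil => intro b x; exact ⟨x, [], by simp, by simp [Alt], by simp [run], by cases b <;> simp [RR]⟩
  | cons y l ih =>
    intro b x
    by_cases hR : RR b x y
    · obtain ⟨h, s, h1, h2, h3, h4⟩ := ih (!b) y
      refine ⟨x, h :: s, h1.cons_cons x, ⟨?_, h2⟩, ?_, ?_⟩
      · cases b <;> simp [RR] at * <;> omega
      · simp [run, hR, h3]; omega
      · cases b <;> simp [RR]
    · obtain ⟨h, s, h1, h2, h3, h4⟩ := ih b y
      refine ⟨h, s, h1.cons x, h2, ?_, ?_⟩
      · simp [run, hR, h3]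
      · cases b <;> simp [RR] at * <;> omega

lemma alt_iff (s : List ℕ) : ∀ b, Alt b s ↔ ∀ j : ℕ, ∀ h : j + 1 < s.length,
    (Even j → RR b s[j] s[j+1]) ∧ (¬ Even j → RR (!b) s[j] s[j+1]) := by
  induction s with
  | nil => intro b; simp [Alt]
  | cons x s ih =>
    cases s with
    | nil => intro b; simp [Alt]
    | cons y s =>
      intro b
      rw [Alt, ih]
      constructor
      · rintro ⟨h1, h2⟩ j h
        cases j with
        | zero => simpa using h1
        | succ j =>
          have := h2 j (by simpa using h)
          rw [Bool.not_not] at this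
          rw [Nat.even_add_one, not_not]
          exact ⟨this.2, this.1⟩
      · intro h
        refine ⟨(h 0 (by simp)).1 (by simp), fun j hj => ?_⟩
        have := h (j+1) (by simpa using hj)
        rw [Nat.even_add_one, not_not] at this
        rw [Bool.not_not]
        exact ⟨this.2, this.1⟩

lemma alt_tail (b : Bool) (x : ℕ) (s : List ℕ) (h : Alt b (x :: s)) : Alt (!b) s := by
  cases s with
  | nil => simp [Alt]
  | cons y s => exact h.2

/-- The word of a permutation, with values shifted to be positive. -/
def word {n : ℕ} (w : Equiv.Perm (Fin n)) : List ℕ := (List.finRange n).map (fun i => (w i : ℕ) + 1)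

lemma isAlt_iff {n : ℕ} (w : Equiv.Perm (Fin n)) (s : List (Fin n)) :
    IsAltSubseq w s ↔ s.Sublist (List.finRange n) ∧ Alt true (s.map (fun i => (w i : ℕ) + 1)) := by
  unfold IsAltSubseq
  refine and_congr ?_ ?_
  · constructor
    · intro h
      have hp : s.Pairwise (· < ·) := List.isChain_iff_pairwise.1 h
      refine List.sublist_of_subperm_of_pairwise (r := (· ≤ ·)) ?_ (hp.imp le_of_lt) ?_
      · exact List.subperm_of_subset (hp.imp ne_of_lt) (fun x _ => List.mem_finRange x)
      · exact (List.pairwise_lt_finRange n).imp le_of_lt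
    · intro h
      exact List.isChain_iff_pairwise.2 ((List.pairwise_lt_finRange n).sublist h)
  · rw [alt_iff]
    simp [RR]

lemma altSubseqLen_eq {n : ℕ} (w : Equiv.Perm (Fin n)) : altSubseqLen w = run false 0 (word w) := by
  unfold altSubseqLen
  refine IsGreatest.csSup_eq ⟨?_, ?_⟩
  · obtain ⟨h, s, h1, h2, h3, h4⟩ := run_exists (word w) false 0
    have h0 : h = 0 := by simpa [RR] using h4
    subst h0
    have h5 := alt_tail _ _ _ h2
    rw [List.cons_sublist_cons] at h1
    obtain ⟨t, ht, rfl⟩ := List.sublist_map_iff.1 h1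
    exact ⟨t, (isAlt_iff w t).2 ⟨ht, h5⟩, by simpa using h3⟩
  · rintro k ⟨s, hs, rfl⟩
    rw [isAlt_iff] at hs
    have := run_upper (word w) false 0 (s.map (fun i => (w i : ℕ) + 1)) (hs.1.map _) ?_
    · simpa using this
    · cases s with
      | nil => simp [Alt]
      | cons x s => exact ⟨by simp [RR], hs.2⟩

def LL : ℕ → List ℕ
  | 0 => []
  | n+1 => (n+1) :: LL n

lemma mem_LL (n x : ℕ) : x ∈ LL n ↔ 1 ≤ x ∧ x ≤ n := by
  induction n with
  | zero => simp [LL]; omega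
  | succ n ih => simp [LL, ih]; omega

lemma nodup_LL (n : ℕ) : (LL n).Nodup := by
  induction n with
  | zero => simp [LL]
  | succ n ih => simp [LL, ih, mem_LL]

lemma length_LL (n : ℕ) : (LL n).length = n := by
  induction n with
  | zero => simp [LL]
  | succ n ih => simp [LL, ih]

lemma word_perm {n : ℕ} (w : Equiv.Perm (Fin n)) : (word w).Perm (LL n) := by
  refine (List.perm_ext_iff_of_nodup ?_ (nodup_LL n)).2 ?_
  · refine List.Nodup.map ?_ (List.nodup_finRange n)
    intro i j h
    simpa [Fin.val_inj] using h
  · intro a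
    rw [mem_LL]
    simp only [word, List.mem_map, List.mem_finRange, true_and]
    constructor
    · rintro ⟨i, rfl⟩
      have := (w i).2
      omega
    · rintro ⟨h1, h2⟩
      exact ⟨w.symm ⟨a - 1, by omega⟩, by simp; omega⟩

lemma word_inj {n : ℕ} : Function.Injective (word (n := n)) := by
  intro w w' h
  unfold word at h
  rw [List.map_inj_left] at h
  ext i
  have := h i (List.mem_finRange i)
  omega

lemma sum_word (n : ℕ) (f : List ℕ → ℚ) : ∑ w : Equiv.Perm (Fin n), f (word w) = ((LL n).permutations'.map f).sum := by
  classical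
  have hn : (LL n).permutations'.Nodup := (List.permutations_perm_permutations' _).nodup_iff.1 (List.nodup_permutations _ (nodup_LL n))
  rw [← List.sum_toFinset _ hn, ← Finset.sum_image (f := f) (g := word) (s := Finset.univ) (fun _ _ _ _ h => word_inj h)]
  congr 1
  refine Finset.eq_of_subset_of_card_le ?_ ?_
  · intro l hl
    obtain ⟨w, _, rfl⟩ := Finset.mem_image.1 hl
    rw [List.mem_toFinset, List.mem_permutations']
    exact word_perm w
  · rw [List.toFinset_card_of_nodup hn, Finset.card_image_of_injective _ word_inj, Finset.card_univ, Fintype.card_perm,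
      (List.permutations_perm_permutations' _).symm.length_eq, List.length_permutations, length_LL, Fintype.card_fin]

lemma insert_sum (t : ℕ) (l : List ℕ) : ∀ (f : ℕ → ℚ) (x : ℕ), (x :: l).Nodup → (∀ y ∈ x :: l, y < t) →
    (((l.permutations'Aux t).map (fun l' => f (run false x l'))).sum =
      (run false x l : ℚ) * f (run false x l) + f (run false x l + 1) + ((l.length : ℚ) - run false x l) * f (run false x l + 2)) ∧
    (((l.permutations'Aux t).map (fun l' => f (run true x l'))).sum + f (1 + run false x l) =
      ((run true x l : ℚ) + 1) * f (run true x l) + f (run true x l + 1) + ((l.length : ℚ) - run true x l) * f (run true x l + 2)) := by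
  induction l with
  | nil =>
    intro f x _ hx
    have : x < t := hx x (by simp)
    simp [run, RR, this, this.not_gt]
  | cons y l ih =>
    intro f x hnd hlt
    have hxt : x < t := hlt x (by simp)
    have hyt : y < t := hlt y (by simp)
    have hxy : x ≠ y := by
      intro h; subst h; simp at hnd
    have hnd' : (y :: l).Nodup := hnd.of_cons
    have hlt' : ∀ z ∈ y :: l, z < t := fun z hz => hlt z (List.mem_cons_of_mem _ hz)
    obtain ⟨i1, i2⟩ := ih f y hnd' hlt'
    obtain ⟨j1, j2⟩ := ih (fun m => f (1 + m)) y hnd' hlt'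
    simp only [List.permutations'Aux, List.map_cons, List.map_map, List.sum_cons, Function.comp_def, List.length_cons]
    have n1 : ∀ a : ℕ, 1 + (1 + a) = a + 2 := fun a => by omega
    have n2 : ∀ a : ℕ, 1 + a + 1 = a + 2 := fun a => by omega
    have n3 : ∀ a : ℕ, 1 + a + 2 = a + 3 := fun a => by omega
    have n4 : ∀ a : ℕ, 1 + (a + 1) = a + 2 := fun a => by omega
    have n5 : ∀ a : ℕ, 1 + (a + 2) = a + 3 := fun a => by omega
    rcases lt_or_gt_of_ne hxy with h | h
    · simp only [run, RR, hxt, h, h.not_gt, hxt.not_gt, hyt, if_true, if_false, Bool.not_true, Bool.not_false,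
        Bool.false_eq_true, n1, n2, n3, n4, n5] at i1 i2 j1 j2 ⊢
      push_cast
      constructor
      · linear_combination j2
      · linear_combination i2
    · simp only [run, RR, hxt, h, h.not_gt, hxt.not_gt, hyt, if_true, if_false, Bool.not_true, Bool.not_false,
        Bool.false_eq_true, n1, n2, n3, n4, n5] at i1 i2 j1 j2 ⊢
      push_cast
      constructor
      · linear_combination i1
      · linear_combination j1

def BB (k n : ℕ) : ℚ := ((LL n).permutations'.map (fun l => if run false 0 l ≤ k then (1:ℚ) else 0)).sum

lemma bkn_eq (k n : ℕ) : (bkn k n : ℚ) = BB k n := by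
  classical
  rw [BB, ← sum_word n (fun l => if run false 0 l ≤ k then (1:ℚ) else 0), bkn, Nat.card_eq_fintype_card, Fintype.card_subtype]
  simp [altSubseqLen_eq]

lemma sum_step (n : ℕ) (f : ℕ → ℚ) : ((LL (n+1)).permutations'.map (fun l => f (run false 0 l))).sum =
    ((LL n).permutations'.map (fun l => (run false 0 l : ℚ) * f (run false 0 l) + f (run false 0 l + 1) + ((n : ℚ) - run false 0 l) * f (run false 0 l + 2))).sum := by
  rw [LL, List.permutations', List.map_flatMap, List.flatMap_def, List.sum_flatten, List.map_map]
  congr 1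
  refine List.map_congr_left fun l hl => ?_
  rw [List.mem_permutations'] at hl
  have hm : ∀ y ∈ l, 1 ≤ y ∧ y ≤ n := fun y hy => (mem_LL n y).1 (hl.mem_iff.1 hy)
  have := (insert_sum (n+1) l f 0 ?_ ?_).1
  · rw [hl.length_eq, length_LL] at this
    exact this
  · rw [List.nodup_cons]
    exact ⟨fun h => by have := hm 0 h; omega, hl.nodup_iff.2 (nodup_LL n)⟩
  · intro y hy
    rcases List.mem_cons.1 hy with rfl | hy
    · omega
    · have := hm y hy; omega

lemma BB_zero (k : ℕ) : BB k 0 = 1 := by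
  simp [BB, LL, run]

lemma BB_zero_left (n : ℕ) : BB 0 (n+1) = 0 := by
  rw [BB, sum_step n (fun m => if m ≤ 0 then (1:ℚ) else 0)]
  apply List.sum_eq_zero
  intro x hx
  obtain ⟨l, _, rfl⟩ := List.mem_map.1 hx
  by_cases h : run false 0 l = 0 <;> simp [h]

lemma BB_one (n : ℕ) : BB 1 (n+1) = BB 1 n := by
  rw [BB, sum_step n (fun m => if m ≤ 1 then (1:ℚ) else 0), BB]
  congr 1
  refine List.map_congr_left fun l hl => ?_
  generalize run false 0 l = m
  rcases m with _ | _ | m <;> simp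

lemma BB_rec (k n : ℕ) : BB (k+2) (n+1) = (k+2) * BB (k+2) n + ((n:ℚ) - 1 - k) * BB k n := by
  rw [BB, sum_step n (fun m => if m ≤ k+2 then (1:ℚ) else 0), BB, BB, ← List.sum_map_mul_left, ← List.sum_map_mul_left,
    ← List.sum_map_add]
  congr 1
  refine List.map_congr_left fun l hl => ?_
  generalize run false 0 l = m
  by_cases h1 : m ≤ k
  · rw [if_pos (by omega), if_pos (by omega), if_pos (by omega), if_pos (by omega)]; ring
  · by_cases h2 : m = k + 1
    · subst h2
      simp; ring
    · by_cases h3 : m = k + 2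
      · subst h3; simp
      · rw [if_neg (by omega), if_neg (by omega), if_neg (by omega), if_neg (by omega)]; ring

lemma BB_eq (n : ℕ) : ∀ k, BB k n = FF k n := by
  induction n with
  | zero => intro k; rw [BB_zero, FF_zero]
  | succ n ih =>
    intro k
    match k with
    | 0 => rw [BB_zero_left, FF_zero_left]
    | 1 => rw [BB_one, ih, FF_one, FF_one]
    | k+2 => rw [BB_rec, FF_rec, ih, ih]

lemma akn_eq (k n : ℕ) (hk : 1 ≤ k) : (akn k n : ℚ) = (bkn k n : ℚ) - (bkn (k - 1) n : ℚ) := by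
  classical
  simp only [akn, bkn, Nat.card_eq_fintype_card, Fintype.card_subtype, Finset.natCast_card_filter]
  rw [← Finset.sum_sub_distrib]
  refine Finset.sum_congr rfl fun w _ => ?_
  rcases lt_trichotomy (altSubseqLen w) k with h | h | h
  · rw [if_neg (by omega), if_pos (by omega), if_pos (by omega)]; ring
  · rw [if_pos (by omega), if_pos (by omega), if_neg (by omega)]; ring
  · rw [if_neg (by omega), if_neg (by omega), if_neg (by omega)]; ring

theorem bkn_formula (k n : ℕ) (hk : 1 ≤ k) (hn : 1 ≤ n) :
    ((bkn k n : ℚ) =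
      (1 / 2 ^ (k - 1)) *
        ∑ r ∈ Finset.range (k + 1), ∑ s ∈ Finset.range (k + 1),
          if r + 2 * s ≤ k ∧ r % 2 = k % 2 then
            (-2 : ℚ) ^ s * ((k - s).choose ((k + r) / 2)) * (n.choose s) * (r : ℚ) ^ n
          else 0) ∧
    (akn k n : ℚ) = (bkn k n : ℚ) - (bkn (k - 1) n : ℚ) := by
  exact ⟨by rw [bkn_eq, BB_eq, FF_formula k n hk hn], akn_eq k n hk⟩
end
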